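/- Let G be a connected graph with capacities c, x and y two vertices, and v the direction of a path from x to y under a spanning representation mapping a spanning tree to the standard basis. Let f_v(k) be the probability (under the uniform measure on the configuration zonotope) that a transaction of size k from x to y fails. Then f_v(k) ≤ k · Γ_{x=y}(c)/Γ(c); hence the success probability is at least 1 − k·Γ_{x=y}(c)/Γ(c). -/

import Mathlib

open MeasureTheory

namespace CreditNet

variable {V E : Type}

/-- A walk in a multigraph with edge-endpoint maps `fst`, `snd`; edges may be
traversed forwards (`fwd`) or backwards (`bwd`). -/
inductive Walk (fst snd : E → V) : V → V → Type where
  | nil (v : V) : Walk fst snd v v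
  | fwd (e : E) {y : V} (w : Walk fst snd (snd e) y) : Walk fst snd (fst e) y
  | bwd (e : E) {y : V} (w : Walk fst snd (fst e) y) : Walk fst snd (snd e) y

/-- The signed sum of a map `D` along a walk: `+D e` for forward traversal of an
edge, `-D e` for backward traversal. -/
def wsum {n : ℕ} {fst snd : E → V} (D : E → Fin n → ℝ) :
    {x y : V} → Walk fst snd x y → (Fin n → ℝ)
  | _, _, .nil _ => 0
  | _, _, .fwd e w => D e + wsum D w
  | _, _, .bwd e w => (-D e) + wsum D w

/-- One adjacency step: either an edge of `T` joins `u` and `v`, or the extra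
identification relation `R` relates them (in either order). -/
def Step (fst snd : E → V) (T : Finset E) (R : V → V → Prop) (u v : V) : Prop :=
  (∃ e ∈ T, (fst e = u ∧ snd e = v) ∨ (fst e = v ∧ snd e = u)) ∨ R u v ∨ R v u

/-- The graph restricted to edge set `T`, with vertices additionally identified
according to `R`, is connected. -/
def ConnVia (fst snd : E → V) (T : Finset E) (R : V → V → Prop) : Prop :=
  ∀ u v : V, Relation.ReflTransGen (Step fst snd T R) u v

/-- No vertex identifications. -/
def NoRel : V → V → Prop := fun _ _ => False

/-- Identify the vertices `x` and `y`. -/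
def Rid (x y : V) : V → V → Prop := fun u v => u = x ∧ v = y

/-- Identify `x` with `y` and `a` with `b`. -/
def Rid2 (x y a b : V) : V → V → Prop := fun u v => (u = x ∧ v = y) ∨ (u = a ∧ v = b)

/-- `T` is a spanning tree of the graph with vertex identifications `R`:
a minimal connecting edge set. -/
def IsSTree [DecidableEq E] (fst snd : E → V) (R : V → V → Prop) (T : Finset E) : Prop :=
  ConnVia fst snd T R ∧ ∀ e ∈ T, ¬ ConnVia fst snd (T.erase e) R

open Classical in
/-- The weighted spanning-tree generating polynomial
`Γ(c) = Σ_{T spanning tree} Π_{e ∈ T} c e` of the graph with vertex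
identifications `R`. -/
noncomputable def treePoly [Fintype E] (fst snd : E → V) (R : V → V → Prop) (c : E → ℝ) : ℝ :=
  ∑ T ∈ Finset.univ.filter (fun T => IsSTree fst snd R T), ∏ e ∈ T, c e

open Classical in
/-- A spanning representation: signed sums along closed walks vanish, and the
images of the edges of any spanning tree span `ℝ^n`. -/
def IsSpanningRep [Fintype E] {n : ℕ} (fst snd : E → V) (D : E → Fin n → ℝ) : Prop :=
  (∀ (x : V) (w : Walk fst snd x x), wsum D w = 0) ∧
  (∀ T : Finset E, IsSTree fst snd NoRel T →
    Submodule.span ℝ (Set.range fun e : T => D e.1) = (⊤ : Submodule ℝ (Fin n → ℝ)))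

/-- An escrow configuration: nonnegative, the two directions of each edge sum
to the capacity, and zero off the edges. -/
def IsConfig (fst snd : E → V) (c : E → ℝ) (w : V → V → ℝ) : Prop :=
  (∀ u v, 0 ≤ w u v) ∧
  (∀ e, w (fst e) (snd e) + w (snd e) (fst e) = c e) ∧
  (∀ u v, (¬ ∃ e, (fst e = u ∧ snd e = v) ∨ (fst e = v ∧ snd e = u)) → w u v = 0)

/-- The represented score of a configuration: sum over positively-oriented
edges of the escrow owned by the tail, times the edge direction. -/
noncomputable def score [Fintype E] {n : ℕ} (fst snd : E → V) (D : E → Fin n → ℝ)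
    (w : V → V → ℝ) : Fin n → ℝ :=
  ∑ e : E, w (fst e) (snd e) • D e

/-- Pay `k` units from `u` to `v` across the edge `(u,v)`. -/
def payEdge [DecidableEq V] (u v : V) (k : ℝ) (w : V → V → ℝ) : V → V → ℝ :=
  fun a b =>
    if a = u ∧ b = v then w a b - k
    else if a = v ∧ b = u then w a b + k else w a b

/-- Execute a payment of `k` units along each edge of a walk. -/
def exec [DecidableEq V] {fst snd : E → V} (k : ℝ) :
    {x y : V} → Walk fst snd x y → (V → V → ℝ) → (V → V → ℝ)
  | _, _, .nil _, w => w
  | _, _, .fwd e p, w => exec k p (payEdge (fst e) (snd e) k w)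
  | _, _, .bwd e p, w => exec k p (payEdge (snd e) (fst e) k w)

/-- Feasibility of paying `k` units along each edge of a walk in turn. -/
def Feasible [DecidableEq V] {fst snd : E → V} (k : ℝ) :
    {x y : V} → Walk fst snd x y → (V → V → ℝ) → Prop
  | _, _, .nil _, _ => True
  | _, _, .fwd e p, w => k ≤ w (fst e) (snd e) ∧ Feasible k p (payEdge (fst e) (snd e) k w)
  | _, _, .bwd e p, w => k ≤ w (snd e) (fst e) ∧ Feasible k p (payEdge (snd e) (fst e) k w)

/-- The zonotope (Minkowski sum of segments) generated by a family of vectors. -/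
def zonotope {ι : Type} [Fintype ι] {n : ℕ} (g : ι → Fin n → ℝ) : Set (Fin n → ℝ) :=
  { z | ∃ lam : ι → ℝ, (∀ i, lam i ∈ Set.Icc (0:ℝ) 1) ∧ z = ∑ i, lam i • g i }

/-! ### Volume of a zonotope -/

lemma zonotope_eq_image {ι : Type} [Fintype ι] {n : ℕ} (g : ι → Fin n → ℝ) :
    zonotope g = (Fintype.linearCombination ℝ g) '' Set.Icc 0 1 := by
  ext z
  simp only [zonotope, Set.mem_ofPred_eq, Set.mem_image, Fintype.linearCombination_apply,
    Set.mem_Icc, Pi.le_def, Pi.zero_apply, Pi.one_apply, forall_and, eq_comm]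

lemma isCompact_zonotope {ι : Type} [Fintype ι] {n : ℕ} (g : ι → Fin n → ℝ) :
    IsCompact (zonotope g) := by
  rw [zonotope_eq_image]
  exact isCompact_Icc.image (LinearMap.continuous_of_finiteDimensional _)

lemma convex_zonotope {ι : Type} [Fintype ι] {n : ℕ} (g : ι → Fin n → ℝ) :
    Convex ℝ (zonotope g) := by
  rw [zonotope_eq_image]
  exact (convex_Icc 0 1).linear_image _

lemma zonotope_map {ι : Type} [Fintype ι] {n m : ℕ} (A : (Fin n → ℝ) →ₗ[ℝ] (Fin m → ℝ))
    (g : ι → Fin n → ℝ) : zonotope (A ∘ g) = A '' zonotope g := by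
  rw [zonotope_eq_image, zonotope_eq_image, Set.image_image]
  congr 1
  ext lam : 1
  simp [Fintype.linearCombination_apply, map_sum]

lemma zonotope_comp_equiv {ι κ : Type} [Fintype ι] [Fintype κ] {n : ℕ} (e : ι ≃ κ)
    (g : κ → Fin n → ℝ) : zonotope (g ∘ e) = zonotope g := by
  ext z
  constructor
  · rintro ⟨lam, h, rfl⟩
    refine ⟨lam ∘ e.symm, fun i => h _, ?_⟩
    exact Fintype.sum_equiv e _ _ (by simp)
  · rintro ⟨lam, h, rfl⟩
    refine ⟨lam ∘ e, fun i => h _, ?_⟩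
    exact (Fintype.sum_equiv e _ _ (by simp)).symm

lemma zonotope_option {ι : Type} [Fintype ι] {n : ℕ} (g : Option ι → Fin n → ℝ) :
    zonotope g = {z | ∃ s ∈ Set.Icc (0 : ℝ) 1, ∃ z' ∈ zonotope (g ∘ some),
      z = s • g none + z'} := by
  ext z
  constructor
  · rintro ⟨lam, h, rfl⟩
    exact ⟨lam none, h _, _, ⟨lam ∘ some, fun i => h _, rfl⟩, by simp [Fintype.sum_option]⟩
  · rintro ⟨s, hs, _, ⟨lam, h, rfl⟩, rfl⟩
    refine ⟨fun o => o.elim s lam, ?_, by simp [Fintype.sum_option]⟩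
    rintro (_ | i)
    · exact hs
    · exact h i

lemma volume_eq_lintegral_cons {m : ℕ} {S : Set (Fin (m + 1) → ℝ)} (hS : MeasurableSet S) :
    volume S = ∫⁻ q : Fin m → ℝ, volume {a : ℝ | Fin.cons a q ∈ S} := by
  have h := (volume_preserving_piFinSuccAbove (fun _ : Fin (m + 1) => ℝ) 0).symm
  rw [← h.measure_preimage hS.nullMeasurableSet]
  erw [Measure.prod_apply_symm (h.measurable hS)]
  refine lintegral_congr fun q => congrArg _ ?_
  ext a
  simp [MeasurableEquiv.piFinSuccAbove, Fin.insertNthEquiv, Fin.insertNth_zero']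

/-- Thickening a convex body by a unit segment in the first coordinate direction adds the volume
of its projection along that direction. -/
lemma volume_add_segment {m : ℕ} {K : Set (Fin (m + 1) → ℝ)} (hK : IsCompact K)
    (hconv : Convex ℝ K)
    (hS : MeasurableSet {z | ∃ s ∈ Set.Icc (0 : ℝ) 1, ∃ z' ∈ K,
      z = s • (Pi.single 0 1 : Fin (m + 1) → ℝ) + z'}) :
    volume {z | ∃ s ∈ Set.Icc (0 : ℝ) 1, ∃ z' ∈ K,
      z = s • (Pi.single 0 1 : Fin (m + 1) → ℝ) + z'} =
      volume K + volume ((Fin.tail : (Fin (m + 1) → ℝ) → Fin m → ℝ) '' K) := by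
  have htail : Continuous (Fin.tail : (Fin (m + 1) → ℝ) → Fin m → ℝ) :=
    continuous_pi fun i => continuous_apply _
  have hP : MeasurableSet ((Fin.tail : (Fin (m + 1) → ℝ) → Fin m → ℝ) '' K) :=
    (hK.image htail).measurableSet
  rw [volume_eq_lintegral_cons hS, volume_eq_lintegral_cons hK.measurableSet,
    ← lintegral_indicator_one hP, ← lintegral_add_right _ (measurable_one.indicator hP)]
  congr 1
  ext q : 1
  have hfib : {a : ℝ | (Fin.cons a q : Fin (m + 1) → ℝ) ∈ {z | ∃ s ∈ Set.Icc (0 : ℝ) 1,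
      ∃ z' ∈ K, z = s • (Pi.single 0 1 : Fin (m + 1) → ℝ) + z'}} =
      {a | ∃ s ∈ Set.Icc (0 : ℝ) 1, ∃ b : ℝ, (Fin.cons b q : Fin (m + 1) → ℝ) ∈ K ∧
        a = s + b} := by
    ext a
    constructor
    · rintro ⟨s, hs, z', hz', h⟩
      refine ⟨s, hs, z' 0, ?_, ?_⟩
      · convert hz' using 1
        ext i
        refine Fin.cases ?_ (fun j => ?_) i
        · simp
        · simpa using congrFun h j.succ
      · simpa using congrFun h 0
    · rintro ⟨s, hs, b, hb, rfl⟩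
      refine ⟨s, hs, _, hb, ?_⟩
      ext i
      refine Fin.cases ?_ (fun j => ?_) i <;> simp
  rw [hfib]
  set F : Set ℝ := {a | (Fin.cons a q : Fin (m + 1) → ℝ) ∈ K} with hF
  by_cases hq : q ∈ (Fin.tail : (Fin (m + 1) → ℝ) → Fin m → ℝ) '' K
  · have hne : F.Nonempty := by
      obtain ⟨z, hz, rfl⟩ := hq
      exact ⟨z 0, by simpa [hF, Fin.cons_self_tail] using hz⟩
    have hFeq : F = (fun z : Fin (m + 1) → ℝ => z 0) '' (K ∩ {z | Fin.tail z = q}) := by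
      ext a
      constructor
      · intro h
        exact ⟨_, ⟨h, by simp⟩, by simp⟩
      · rintro ⟨z, ⟨hz, rfl⟩, rfl⟩
        simpa [hF, Fin.cons_self_tail] using hz
    have hFc : IsCompact F := by
      rw [hFeq]
      exact (hK.inter_right (isClosed_eq htail continuous_const)).image (continuous_apply 0)
    have hFv : Convex ℝ F := by
      intro a ha b hb u v hu hv huv
      have := hconv ha hb hu hv huv
      show (Fin.cons _ q : Fin (m + 1) → ℝ) ∈ K
      convert this using 1
      ext i
      refine Fin.cases ?_ (fun j => ?_) i
      · simp
      · simp [← add_mul, huv]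
    have hIcc := eq_Icc_of_connected_compact ⟨hne, hFv.isPreconnected⟩ hFc
    set α := sInf F
    set β := sSup F
    have hαβ : α ≤ β := by
      rw [hIcc] at hne
      exact Set.nonempty_Icc.mp hne
    have h2 : {a | ∃ s ∈ Set.Icc (0 : ℝ) 1, ∃ b : ℝ, (Fin.cons b q : Fin (m + 1) → ℝ) ∈ K ∧
        a = s + b} = Set.Icc α (β + 1) := by
      have hmem : ∀ b, (Fin.cons b q : Fin (m + 1) → ℝ) ∈ K ↔ b ∈ Set.Icc α β := by
        intro b
        rw [← hIcc]
        rfl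
      ext a
      simp only [hmem, Set.mem_ofPred_eq, Set.mem_Icc]
      constructor
      · rintro ⟨s, hs, b, hb, rfl⟩
        constructor <;> linarith
      · rintro ⟨h1, h2⟩
        rcases le_total a β with h | h
        · exact ⟨0, by norm_num, a, ⟨h1, h⟩, by ring⟩
        · exact ⟨a - β, ⟨by linarith, by linarith⟩, β, ⟨hαβ, le_rfl⟩, by ring⟩
    rw [h2, hIcc, Set.indicator_of_mem hq, Real.volume_Icc, Real.volume_Icc, Pi.one_apply,
      ← ENNReal.ofReal_one, ← ENNReal.ofReal_add (by linarith) zero_le_one]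
    congr 1
    ring
  · have hFe : ∀ b, (Fin.cons b q : Fin (m + 1) → ℝ) ∉ K := fun b hb => hq ⟨_, hb, by simp⟩
    rw [Set.indicator_of_notMem hq]
    simp [hF, hFe]

/-- The sum of the absolute values of the maximal minors of a family of vectors, taken over all
ordered choices of rows. -/
noncomputable def detSum {ι : Type} [Fintype ι] {n : ℕ} (g : ι → Fin n → ℝ) : ℝ :=
  ∑ f : Fin n → ι, |(Matrix.of (g ∘ f)).det|

lemma detSum_nonneg {ι : Type} [Fintype ι] {n : ℕ} (g : ι → Fin n → ℝ) : 0 ≤ detSum g :=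
  Finset.sum_nonneg fun _ _ => abs_nonneg _

lemma detSum_comp_equiv {ι κ : Type} [Fintype ι] [Fintype κ] {n : ℕ} (e : ι ≃ κ)
    (g : κ → Fin n → ℝ) : detSum (g ∘ e) = detSum g :=
  Fintype.sum_equiv (Equiv.arrowCongr (Equiv.refl _) e) _ _ fun _ => rfl

lemma detSum_map {ι : Type} [Fintype ι] {n : ℕ} (A : (Fin n → ℝ) →ₗ[ℝ] (Fin n → ℝ))
    (g : ι → Fin n → ℝ) : detSum (A ∘ g) = |LinearMap.det A| * detSum g := by
  rw [detSum, detSum, Finset.mul_sum]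
  refine Finset.sum_congr rfl fun f _ => ?_
  rw [← abs_mul, ← Pi.basisFun_det_apply, ← Pi.basisFun_det_apply, Function.comp_assoc,
    Module.Basis.det_comp]

/-- Splitting a sum over functions into `Option ι` that vanishes as soon as `none` is taken
twice. -/
lemma sum_fun_option {ι : Type} [Fintype ι] {m : ℕ} (F : (Fin (m + 1) → Option ι) → ℝ)
    (hF : ∀ f i j, i ≠ j → f i = none → f j = none → F f = 0) :
    ∑ f, F f = ∑ f : Fin (m + 1) → ι, F (some ∘ f) +
      ∑ j : Fin (m + 1), ∑ f : Fin m → ι,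
        F (j.insertNth (α := fun _ => Option ι) none (some ∘ f)) := by
  classical
  rw [← Fintype.sum_prod_type', ← Fintype.sum_sumElim]
  symm
  refine Fintype.sum_of_injective
    (Sum.elim (fun f : Fin (m + 1) → ι => some ∘ f)
      (fun q : Fin (m + 1) × (Fin m → ι) =>
        q.1.insertNth (α := fun _ => Option ι) none (some ∘ q.2))) ?_ _ _ ?_ ?_
  · rintro (f | ⟨j, f⟩) (f' | ⟨j', f'⟩) h
    · simp only [Sum.elim_inl] at h
      congr 1
      ext i
      exact Option.some_injective _ (congrFun h i)
    · have := congrFun h j'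
      simp at this
    · have := congrFun h j
      simp at this
    · simp only [Sum.elim_inr] at h
      have hj : j = j' := by
        by_contra hne
        obtain ⟨i, hi⟩ := Fin.exists_succAbove_eq hne
        have := congrFun h j
        rw [← hi] at this
        simp at this
      subst hj
      congr 2
      ext i
      have := congrFun h (j.succAbove i)
      simpa using this
  · intro f hf
    by_cases h0 : ∃ j, f j = none
    · obtain ⟨j, hj⟩ := h0
      by_cases h1 : ∃ i, i ≠ j ∧ f i = none
      · obtain ⟨i, hi, hi'⟩ := h1
        exact hF f i j hi hi' hj
      · push Not at h1
        refine absurd ⟨Sum.inr (j, fun i => (f (j.succAbove i)).get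
          (Option.isSome_iff_ne_none.mpr (h1 _ (Fin.succAbove_ne j i)))), ?_⟩ hf
        ext1 i
        rcases Fin.eq_self_or_eq_succAbove j i with rfl | ⟨i, rfl⟩ <;> simp [hj]
    · push Not at h0
      refine absurd ⟨Sum.inl fun i => (f i).get (Option.isSome_iff_ne_none.mpr (h0 i)), ?_⟩ hf
      ext1 i
      simp
  · rintro (f | ⟨j, f⟩) <;> rfl

lemma det_eq_zero_of_none_twice {ι : Type} {n : ℕ} (g : Option ι → Fin n → ℝ)
    (f : Fin n → Option ι) (i j : Fin n) (hij : i ≠ j) (hi : f i = none) (hj : f j = none) :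
    |(Matrix.of (g ∘ f)).det| = 0 := by
  rw [abs_eq_zero]
  refine Matrix.det_zero_of_row_eq hij ?_
  show g (f i) = g (f j)
  rw [hi, hj]

lemma detSum_option_of_single {ι : Type} [Fintype ι] {m : ℕ} (g : Option ι → Fin (m + 1) → ℝ)
    (hg : g none = Pi.single 0 1) :
    detSum g = detSum (g ∘ some) + (m + 1) * detSum (Fin.tail ∘ g ∘ some) := by
  rw [detSum, sum_fun_option _ (det_eq_zero_of_none_twice g)]
  have hminor : ∀ (j : Fin (m + 1)) (f : Fin m → ι),
      |(Matrix.of (g ∘ j.insertNth (α := fun _ => Option ι) none (some ∘ f))).det| =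
        |(Matrix.of ((Fin.tail ∘ g ∘ some) ∘ f)).det| := by
    intro j f
    rw [Matrix.det_succ_row _ j, Finset.sum_eq_single 0]
    · rw [abs_mul, abs_mul, abs_pow, abs_neg, abs_one, one_pow, one_mul]
      have : (Matrix.of (g ∘ j.insertNth (α := fun _ => Option ι) none (some ∘ f))) j 0 = 1 := by
        simp [hg]
      rw [this, abs_one, one_mul]
      congr 2
      ext a b
      simp [Fin.tail]
    · intro b _ hb
      simp [hg, hb]
    · simp
  simp only [hminor, Finset.sum_const, Finset.card_univ, Fintype.card_fin, nsmul_eq_mul,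
    Nat.cast_add, Nat.cast_one]
  rfl

lemma detSum_option_of_zero {ι : Type} [Fintype ι] {m : ℕ} (g : Option ι → Fin (m + 1) → ℝ)
    (hg : g none = 0) : detSum g = detSum (g ∘ some) := by
  rw [detSum, sum_fun_option _ (det_eq_zero_of_none_twice g)]
  refine add_eq_left.mpr (Finset.sum_eq_zero fun j _ => Finset.sum_eq_zero fun f _ => ?_)
  rw [abs_eq_zero]
  apply Matrix.det_eq_zero_of_row_eq_zero j
  simp [hg]

/-- The volume formula for zonotopes. -/
theorem factorial_mul_volume_zonotope {ι : Type} [Fintype ι] : ∀ (n : ℕ) (g : ι → Fin n → ℝ),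
    (n.factorial : ENNReal) * volume (zonotope g) = ENNReal.ofReal (detSum g) := by
  have hzero : ∀ {κ : Type} [Fintype κ] (g : κ → Fin 0 → ℝ),
      ((0 : ℕ).factorial : ENNReal) * volume (zonotope g) = ENNReal.ofReal (detSum g) := by
    intro κ _ g
    have : zonotope g = Set.univ :=
      Set.eq_univ_of_forall fun z => ⟨0, by simp, Subsingleton.elim _ _⟩
    simp [this, detSum, volume_pi]
  refine Fintype.induction_empty_option (P := fun κ [Fintype κ] => ∀ (n : ℕ)
    (g : κ → Fin n → ℝ),
    (n.factorial : ENNReal) * volume (zonotope g) = ENNReal.ofReal (detSum g)) ?_ ?_ ?_ ι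
  · intro α β _ e ih n g
    let := Fintype.ofEquiv β e.symm
    have := ih n (g ∘ e)
    rw [zonotope_comp_equiv, detSum_comp_equiv] at this
    convert this
  · rintro (_ | n) g
    · exact hzero g
    · have : zonotope g = {0} := by
        ext z
        simp [zonotope]
      simp [this, detSum]
  · rintro α _ ih (_ | m) g
    · exact hzero g
    by_cases h0 : g none = 0
    · have : zonotope g = zonotope (g ∘ some) := by
        rw [zonotope_option]
        ext z
        simp only [h0, smul_zero, zero_add, Set.mem_ofPred_eq, exists_eq_right']
        exact ⟨fun ⟨_, _, h⟩ => h, fun h => ⟨0, by norm_num, h⟩⟩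
      rw [this, detSum_option_of_zero g h0, ih]
    · obtain ⟨A, hA⟩ := SeparatingDual.exists_continuousLinearEquiv_apply_eq (R := ℝ) h0
        (y := (Pi.single 0 1 : Fin (m + 1) → ℝ)) (by simp)
      set B : (Fin (m + 1) → ℝ) →ₗ[ℝ] (Fin (m + 1) → ℝ) := A.toLinearEquiv.toLinearMap
      have hdet : LinearMap.det B ≠ 0 := (LinearEquiv.isUnit_det' A.toLinearEquiv).ne_zero
      have key : ((m + 1).factorial : ENNReal) * volume (zonotope (B ∘ g)) =
          ENNReal.ofReal (detSum (B ∘ g)) := by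
        have hBg : (B ∘ g) none = Pi.single 0 1 := hA
        set g' := B ∘ g
        let π : (Fin (m + 1) → ℝ) →ₗ[ℝ] (Fin m → ℝ) := LinearMap.funLeft ℝ ℝ Fin.succ
        have hπ : (Fin.tail : (Fin (m + 1) → ℝ) → Fin m → ℝ) = π := rfl
        have hm := (isCompact_zonotope g').measurableSet
        rw [zonotope_option, hBg] at hm
        rw [zonotope_option, hBg, volume_add_segment (isCompact_zonotope _) (convex_zonotope _) hm,
          mul_add, ih, detSum_option_of_single g' hBg,
          ENNReal.ofReal_add (detSum_nonneg _)
            (mul_nonneg (by positivity) (detSum_nonneg _)), hπ, ← zonotope_map,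
          Nat.factorial_succ, Nat.cast_mul, mul_assoc, ih, ENNReal.ofReal_mul (by positivity)]
        congr 2
        rw [show ((m : ℝ) + 1) = ((m + 1 : ℕ) : ℝ) by push_cast; rfl, ENNReal.ofReal_natCast]
      rw [zonotope_map, Measure.addHaar_image_linearMap, detSum_map,
        ENNReal.ofReal_mul (abs_nonneg _), mul_left_comm] at key
      exact (ENNReal.mul_right_inj (by simpa using hdet) ENNReal.ofReal_ne_top).mp key

/-! ### Walks and potentials -/

lemma exists_walk_append {n : ℕ} {fst snd : E → V} (D : E → Fin n → ℝ) {a b d : V}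
    (p : Walk fst snd a b) (q : Walk fst snd b d) :
    ∃ w : Walk fst snd a d, wsum D w = wsum D p + wsum D q := by
  induction p with
  | nil v => exact ⟨q, by simp [wsum]⟩
  | fwd e p ih =>
    obtain ⟨w, hw⟩ := ih q
    exact ⟨.fwd e w, by simp [wsum, hw, add_assoc]⟩
  | bwd e p ih =>
    obtain ⟨w, hw⟩ := ih q
    exact ⟨.bwd e w, by simp [wsum, hw, add_assoc]⟩

lemma exists_walk_reverse {n : ℕ} {fst snd : E → V} (D : E → Fin n → ℝ) {a b : V}
    (p : Walk fst snd a b) : ∃ w : Walk fst snd b a, wsum D w = -wsum D p := by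
  induction p with
  | nil v => exact ⟨.nil v, by simp [wsum]⟩
  | fwd e p ih =>
    obtain ⟨w, hw⟩ := ih
    obtain ⟨w', hw'⟩ := exists_walk_append D w (.bwd e (.nil (fst e)))
    exact ⟨w', by simp [hw', hw, wsum]⟩
  | bwd e p ih =>
    obtain ⟨w, hw⟩ := ih
    obtain ⟨w', hw'⟩ := exists_walk_append D w (.fwd e (.nil (snd e)))
    exact ⟨w', by simp [hw', hw, wsum]⟩

lemma exists_walk_of_reachable {fst snd : E → V} {T : Finset E} {u v : V}
    (h : Relation.ReflTransGen (Step fst snd T NoRel) u v) : Nonempty (Walk fst snd u v) := by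
  induction h using Relation.ReflTransGen.head_induction_on with
  | refl => exact ⟨.nil v⟩
  | head hs _ ih =>
    obtain ⟨w⟩ := ih
    obtain ⟨e, -, ⟨rfl, rfl⟩ | ⟨rfl, rfl⟩⟩ | h | h := hs
    · exact ⟨.fwd e w⟩
    · exact ⟨.bwd e w⟩
    · exact h.elim
    · exact h.elim

/-- A map on edges whose sums along closed walks vanish is the gradient of a vertex potential. -/
lemma exists_potential {n : ℕ} [Nonempty V] {fst snd : E → V} {T : Finset E}
    (hconn : ConnVia fst snd T NoRel) (D : E → Fin n → ℝ)
    (hD : ∀ (x : V) (w : Walk fst snd x x), wsum D w = 0) :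
    ∃ pot : V → Fin n → ℝ, ∀ e, D e = pot (snd e) - pot (fst e) := by
  obtain ⟨r⟩ := ‹Nonempty V›
  have W : ∀ v, Nonempty (Walk fst snd r v) := fun v => exists_walk_of_reachable (hconn r v)
  refine ⟨fun v => wsum D (W v).some, fun e => ?_⟩
  obtain ⟨w1, h1⟩ := exists_walk_reverse D (W (snd e)).some
  obtain ⟨w2, h2⟩ := exists_walk_append D (W (fst e)).some (.fwd e w1)
  have h3 := hD r w2
  rw [h2, wsum, h1] at h3
  rw [← sub_eq_zero, ← h3]
  abel

lemma wsum_eq_sub {n : ℕ} {fst snd : E → V} {D : E → Fin n → ℝ} {pot : V → Fin n → ℝ}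
    (hpot : ∀ e, D e = pot (snd e) - pot (fst e)) {x y : V} (p : Walk fst snd x y) :
    wsum D p = pot y - pot x := by
  induction p with
  | nil v => simp [wsum]
  | fwd e p ih => rw [wsum, ih, hpot]; abel
  | bwd e p ih => rw [wsum, ih, hpot]; abel

lemma sub_mem_of_reachable {M : Type} [AddCommGroup M] {fst snd : E → V} {D : E → M}
    {pot : V → M} (hpot : ∀ e, D e = pot (snd e) - pot (fst e)) {T : Finset E}
    {H : AddSubgroup M} (hH : ∀ e ∈ T, D e ∈ H) {u v : V}
    (h : Relation.ReflTransGen (Step fst snd T NoRel) u v) : pot v - pot u ∈ H := by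
  induction h with
  | refl => simp
  | tail _ hs ih =>
    obtain ⟨e, he, ⟨rfl, rfl⟩ | ⟨rfl, rfl⟩⟩ | h | h := hs
    · have := H.add_mem ih (hH e he)
      rw [hpot] at this
      convert this using 1
      abel
    · have := H.sub_mem ih (hH e he)
      rw [hpot] at this
      convert this using 1
      abel
    · exact h.elim
    · exact h.elim

lemma ConnVia.mono {fst snd : E → V} {R : V → V → Prop} {S T : Finset E}
    (h : ConnVia fst snd S R) (hST : S ⊆ T) : ConnVia fst snd T R := by
  intro u v
  refine Relation.ReflTransGen.mono (fun a b hs => ?_) u v (h u v)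
  obtain ⟨e, he, h⟩ | h := hs
  · exact Or.inl ⟨e, hST he, h⟩
  · exact Or.inr h

/-! ### Connectivity after adding an edge -/

lemma step_option_iff {fst snd : E → V} {x y : V} {T : Finset E} {T' : Finset (Option E)}
    {R R' : V → V → Prop} (hT : ∀ e, some e ∈ T' ↔ e ∈ T)
    (hR : ∀ u v, R u v ↔ (none ∈ T' ∧ Rid x y u v) ∨ R' u v) (u v : V) :
    Step (fun o : Option E => o.elim x fst) (fun o => o.elim y snd) T' R' u v ↔
      Step fst snd T R u v := by
  simp only [Step, Option.exists, Option.elim, hT, hR, Rid]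
  generalize (∃ e ∈ T, (fst e = u ∧ snd e = v) ∨ (fst e = v ∧ snd e = u)) = Q
  constructor
  · rintro ((⟨h, ⟨rfl, rfl⟩ | ⟨rfl, rfl⟩⟩ | h) | h | h) <;> tauto
  · rintro (h | ((⟨h, rfl, rfl⟩ | h) | (⟨h, rfl, rfl⟩ | h))) <;> tauto

lemma conn_option_iff {fst snd : E → V} {x y : V} {T : Finset E} {T' : Finset (Option E)}
    {R R' : V → V → Prop} (hT : ∀ e, some e ∈ T' ↔ e ∈ T)
    (hR : ∀ u v, R u v ↔ (none ∈ T' ∧ Rid x y u v) ∨ R' u v) :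
    ConnVia (fun o : Option E => o.elim x fst) (fun o => o.elim y snd) T' R' ↔
      ConnVia fst snd T R := by
  have : Step (fun o : Option E => o.elim x fst) (fun o => o.elim y snd) T' R' =
      Step fst snd T R := by
    ext u v
    exact step_option_iff hT hR u v
  rw [ConnVia, ConnVia, this]

lemma treePoly_nonneg [Fintype E] (fst snd : E → V) (R : V → V → Prop) {c : E → ℝ}
    (hc : ∀ e, 0 ≤ c e) :
    0 ≤ treePoly fst snd R c :=
  Finset.sum_nonneg fun _ _ => Finset.prod_nonneg fun e _ => hc e

/-! ### Minors of a unimodular graph representation -/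

lemma span_eq_top_of_conn {n : ℕ} {fst snd : E → V} {D : E → Fin n → ℝ}
    {pot : V → Fin n → ℝ} (hpot : ∀ e, D e = pot (snd e) - pot (fst e))
    {t : Fin n → E} (hbasis : ∀ i, D (t i) = Pi.single i 1)
    {ι : Type} {b : ι → Fin n → ℝ} {T : Finset E} (hT : ConnVia fst snd T NoRel)
    (hb : ∀ e ∈ T, D e ∈ Submodule.span ℝ (Set.range b)) :
    Submodule.span ℝ (Set.range b) = ⊤ := by
  rw [eq_top_iff, ← (Pi.basisFun ℝ (Fin n)).span_eq, Submodule.span_le]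
  rintro _ ⟨i, rfl⟩
  rw [Pi.basisFun_apply, ← hbasis, hpot]
  exact sub_mem_of_reachable hpot (H := (Submodule.span ℝ (Set.range b)).toAddSubgroup) hb
    (hT _ _)

variable [DecidableEq E]

/-- Rows with nonvanishing minor connect the graph. -/
lemma conn_of_det_ne_zero [Fintype V] {n : ℕ} (hcard : Fintype.card V = n + 1) {fst snd : E → V}
    {D : E → Fin n → ℝ} {pot : V → Fin n → ℝ} (hpot : ∀ e, D e = pot (snd e) - pot (fst e))
    {t : Fin n → E} (hbasis : ∀ i, D (t i) = Pi.single i 1)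
    {f : Fin n → E} (hdet : (Matrix.of (D ∘ f)).det ≠ 0) :
    ConnVia fst snd (Finset.univ.image f) NoRel := by
  classical
  have hli : LinearIndependent ℝ (D ∘ f) :=
    Matrix.linearIndependent_rows_iff_isUnit.mpr
      ((Matrix.isUnit_iff_isUnit_det _).mpr hdet.isUnit)
  have hspan := hli.span_eq_top_of_card_eq_finrank' (by simp)
  intro u
  set C : Set V := {w | Relation.ReflTransGen (Step fst snd (Finset.univ.image f) NoRel) u w}
  let b : {w : V // w ≠ u} → Fin n → ℝ := fun w => pot w - pot u
  have hmem : ∀ w, pot w - pot u ∈ Submodule.span ℝ (Set.range b) := by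
    intro w
    by_cases hw : w = u
    · simp [hw]
    · exact Submodule.subset_span ⟨⟨w, hw⟩, rfl⟩
  have htop : ⊤ ≤ Submodule.span ℝ (Set.range b) := by
    rw [← (Pi.basisFun ℝ (Fin n)).span_eq, Submodule.span_le]
    rintro _ ⟨i, rfl⟩
    rw [Pi.basisFun_apply, ← hbasis, hpot]
    have := Submodule.sub_mem _ (hmem (snd (t i))) (hmem (fst (t i)))
    rwa [sub_sub_sub_cancel_right] at this
  let B := basisOfTopLeSpanOfCardEqFinrank b htop (by
    rw [Fintype.card_subtype_compl]
    simp [hcard])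
  let χ : (Fin n → ℝ) →ₗ[ℝ] ℝ := B.constr ℝ fun w => if w.1 ∈ C then 0 else 1
  have hχ : ∀ w, χ (pot w - pot u) = if w ∈ C then 0 else 1 := by
    intro w
    by_cases hw : w = u
    · have : u ∈ C := Relation.ReflTransGen.refl
      simp [hw, this]
    · have : pot w - pot u = B ⟨w, hw⟩ := by simp [B, b]
      rw [this, Module.Basis.constr_basis]
  have hzero : χ = 0 := by
    refine LinearMap.ext_on_range hspan fun i => ?_
    have hstep : fst (f i) ∈ C ↔ snd (f i) ∈ C := by
      constructor
      · intro h
        exact Relation.ReflTransGen.tail h (Or.inl ⟨f i, by simp, Or.inl ⟨rfl, rfl⟩⟩)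
      · intro h
        exact Relation.ReflTransGen.tail h (Or.inl ⟨f i, by simp, Or.inr ⟨rfl, rfl⟩⟩)
    have : (D ∘ f) i = (pot (snd (f i)) - pot u) - (pot (fst (f i)) - pot u) := by
      rw [sub_sub_sub_cancel_right, Function.comp_apply, hpot]
    rw [this, map_sub, hχ, hχ]
    simp [hstep]
  intro v
  by_contra hv
  have hvC : v ∉ C := hv
  have := hχ v
  rw [hzero, if_neg hvC] at this
  simp at this

/-- Rows with nonvanishing minor form a spanning tree. -/
lemma isSTree_of_det_ne_zero [Fintype V] {n : ℕ} (hcard : Fintype.card V = n + 1) {fst snd : E → V}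
    {D : E → Fin n → ℝ} {pot : V → Fin n → ℝ} (hpot : ∀ e, D e = pot (snd e) - pot (fst e))
    {t : Fin n → E} (hbasis : ∀ i, D (t i) = Pi.single i 1)
    {f : Fin n → E} (hdet : (Matrix.of (D ∘ f)).det ≠ 0) :
    Function.Injective f ∧ IsSTree fst snd NoRel (Finset.univ.image f) := by
  have hli : LinearIndependent ℝ (D ∘ f) :=
    Matrix.linearIndependent_rows_iff_isUnit.mpr
      ((Matrix.isUnit_iff_isUnit_det _).mpr hdet.isUnit)
  refine ⟨hli.injective.of_comp, conn_of_det_ne_zero hcard hpot hbasis hdet, ?_⟩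
  intro e he hconn
  obtain ⟨i, -, rfl⟩ := Finset.mem_image.mp he
  refine hli.notMem_span_image (s := {i}ᶜ) (x := i) (by simp) ?_
  rw [Function.comp_apply, hpot]
  refine sub_mem_of_reachable hpot
    (H := (Submodule.span ℝ (D ∘ f '' {i}ᶜ)).toAddSubgroup) ?_ (hconn _ _)
  intro e he
  obtain ⟨hne, he⟩ := Finset.mem_erase.mp he
  obtain ⟨j, -, rfl⟩ := Finset.mem_image.mp he
  exact Submodule.subset_span ⟨j, fun h => hne (congrArg f h), rfl⟩

/-- A spanning tree of a graph with `n + 1` vertices has `n` edges. -/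
lemma card_of_isSTree [Fintype V] {n : ℕ} (hcard : Fintype.card V = n + 1) {fst snd : E → V}
    {D : E → Fin n → ℝ} {pot : V → Fin n → ℝ} (hpot : ∀ e, D e = pot (snd e) - pot (fst e))
    {t : Fin n → E} (hbasis : ∀ i, D (t i) = Pi.single i 1)
    {T : Finset E} (hT : IsSTree fst snd NoRel T) : T.card = n := by
  have htop : Submodule.span ℝ (Set.range fun e : T => D e) = ⊤ :=
    span_eq_top_of_conn hpot hbasis hT.1 fun e he => Submodule.subset_span ⟨⟨e, he⟩, rfl⟩
  obtain ⟨κ, a, ha, hsp, hli⟩ := exists_linearIndependent' ℝ (fun e : T => D e)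
  rw [htop] at hsp
  have : Finite κ := Finite.of_injective a ha
  let _ := Fintype.ofFinite κ
  have hκ : Fintype.card κ = n := by
    have := finrank_span_eq_card hli
    rw [hsp] at this
    simpa using this.symm
  let ε := (Fintype.equivFinOfCardEq hκ).symm
  let f : Fin n → E := fun i => a (ε i)
  have hf : Function.Injective f := Subtype.val_injective.comp (ha.comp ε.injective)
  have hli' : LinearIndependent ℝ (D ∘ f) := hli.comp ε ε.injective
  have hdet : (Matrix.of (D ∘ f)).det ≠ 0 :=
    ((Matrix.isUnit_iff_isUnit_det _).mp (Matrix.linearIndependent_rows_iff_isUnit.mp hli')).ne_zero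
  have hconn := conn_of_det_ne_zero hcard hpot hbasis hdet
  have himg : Finset.univ.image f = T := by
    refine Finset.Subset.antisymm ?_ ?_
    · intro e he
      obtain ⟨i, -, rfl⟩ := Finset.mem_image.mp he
      exact (a (ε i)).2
    · intro e he
      by_contra hne
      refine hT.2 e he (hconn.mono fun e' he' => ?_)
      refine Finset.mem_erase.mpr ⟨fun h => hne (h ▸ he'), ?_⟩
      obtain ⟨i, -, rfl⟩ := Finset.mem_image.mp he'
      exact (a (ε i)).2
  rw [← himg, Finset.card_image_of_injective _ hf, Finset.card_fin]

/-- Minors indexed by spanning trees are unimodular. -/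
lemma abs_det_eq_one {n : ℕ} {fst snd : E → V}
    {D : E → Fin n → ℝ} {pot : V → Fin n → ℝ} (hpot : ∀ e, D e = pot (snd e) - pot (fst e))
    {t : Fin n → E} (hbasis : ∀ i, D (t i) = Pi.single i 1)
    (ht : ConnVia fst snd (Finset.univ.image t) NoRel)
    {f : Fin n → E} (hf : ConnVia fst snd (Finset.univ.image f) NoRel) :
    |(Matrix.of (D ∘ f)).det| = 1 := by
  have comb : ∀ g : Fin n → E, ConnVia fst snd (Finset.univ.image g) NoRel → ∀ e,
      ∃ a : Fin n → ℤ, ∑ i, a i • D (g i) = D e := by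
    intro g hg e
    refine (Submodule.mem_span_range_iff_exists_fun ℤ (v := D ∘ g)).mp ?_
    rw [hpot]
    refine sub_mem_of_reachable hpot
      (H := (Submodule.span ℤ (Set.range (D ∘ g))).toAddSubgroup) ?_ (hg _ _)
    intro e he
    obtain ⟨j, -, rfl⟩ := Finset.mem_image.mp he
    exact Submodule.subset_span ⟨j, rfl⟩
  choose N hN using fun i => comb t ht (f i)
  choose P hP using fun i => comb f hf (t i)
  have hM : Matrix.of (D ∘ f) = (Matrix.of N).map (Int.castRingHom ℝ) := by
    ext i j
    have := congrFun (hN i) j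
    simp only [hbasis, Finset.sum_apply, Pi.smul_apply, Pi.single_apply] at this
    simpa using this.symm
  have hPM : (Matrix.of P).map (Int.castRingHom ℝ) * Matrix.of (D ∘ f) = 1 := by
    ext i j
    have := congrFun (hP i) j
    simp only [hbasis, Finset.sum_apply, zsmul_eq_mul] at this
    rw [Matrix.mul_apply, Matrix.one_apply, ← Pi.single_apply, Pi.single_comm]
    simpa using this
  have hdet := congrArg Matrix.det hPM
  rw [Matrix.det_mul, Matrix.det_one, hM, ← RingHom.mapMatrix_apply, ← RingHom.mapMatrix_apply,
    ← RingHom.map_det, ← RingHom.map_det, ← map_mul] at hdet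
  have hPN : (Matrix.of P).det * (Matrix.of N).det = 1 := by
    exact Int.cast_injective (α := ℝ) (by simpa only [eq_intCast, Int.cast_one] using hdet)
  rw [hM, ← RingHom.mapMatrix_apply, ← RingHom.map_det]
  rcases Int.isUnit_iff.mp (IsUnit.of_mul_eq_one_right _ hPN) with h | h <;> simp [h]

lemma isSTree_of_map_some {fst snd : E → V} {x y : V} {T : Finset E}
    (h : IsSTree (fun o : Option E => o.elim x fst) (fun o => o.elim y snd) NoRel
      (T.map Function.Embedding.some)) : IsSTree fst snd NoRel T := by
  refine ⟨(conn_option_iff (by simp) (by simp [NoRel])).mp h.1, fun e he hconn => ?_⟩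
  refine h.2 (some e) (by simpa using he) ?_
  exact (conn_option_iff (by simp) (by simp [NoRel])).mpr hconn

lemma isSTree_of_insertNone {fst snd : E → V} {x y : V} {T : Finset E}
    (h : IsSTree (fun o : Option E => o.elim x fst) (fun o => o.elim y snd) NoRel
      (Finset.insertNone T)) : IsSTree fst snd (Rid x y) T := by
  refine ⟨(conn_option_iff (by simp) (by simp [NoRel])).mp h.1, fun e he hconn => ?_⟩
  refine h.2 (some e) (by simpa using he) ?_
  exact (conn_option_iff (by simp) (by simp [NoRel])).mpr hconn

variable [Fintype E]

lemma card_enum {n : ℕ} {T : Finset E} (hT : T.card = n) :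
    (Finset.univ.filter fun f : Fin n → E =>
      Function.Injective f ∧ Finset.univ.image f = T).card = n.factorial := by
  have h := Fintype.card_embedding_eq (α := Fin n) (β := T)
  rw [Fintype.card_coe, hT, Fintype.card_fin, Nat.descFactorial_self] at h
  rw [← h, ← Finset.card_univ]
  symm
  refine Finset.card_bij (fun φ _ i => (φ i : E)) ?_ ?_ ?_
  · intro φ _
    have hφ : Function.Injective fun i => (φ i : E) := Subtype.val_injective.comp φ.injective
    refine Finset.mem_filter.mpr ⟨Finset.mem_univ _, hφ, ?_⟩
    refine Finset.eq_of_subset_of_card_le ?_ ?_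
    · intro e he
      obtain ⟨i, -, rfl⟩ := Finset.mem_image.mp he
      exact (φ i).2
    · rw [Finset.card_image_of_injective _ hφ, Finset.card_fin, hT]
  · intro φ _ ψ _ h
    ext i
    exact congrFun h i
  · intro f hf
    obtain ⟨-, hinj, himg⟩ := Finset.mem_filter.mp hf
    refine ⟨⟨fun i => ⟨f i, himg ▸ Finset.mem_image_of_mem f (Finset.mem_univ i)⟩,
      fun i j h => hinj (Subtype.ext_iff.mp h)⟩, Finset.mem_univ _, rfl⟩

open Classical in
lemma treePoly_eq (fst snd : E → V) (R : V → V → Prop) (c : E → ℝ) :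
    treePoly fst snd R c =
      ∑ T ∈ Finset.univ.filter (fun T => IsSTree fst snd R T), ∏ e ∈ T, c e := by
  unfold treePoly
  congr!

lemma detSum_eq_treePoly [Fintype V] {n : ℕ} (hcard : Fintype.card V = n + 1) {fst snd : E → V}
    {D : E → Fin n → ℝ} {pot : V → Fin n → ℝ} (hpot : ∀ e, D e = pot (snd e) - pot (fst e))
    {t : Fin n → E} (hbasis : ∀ i, D (t i) = Pi.single i 1)
    (ht : ConnVia fst snd (Finset.univ.image t) NoRel)
    {c : E → ℝ} (hc : ∀ e, 0 ≤ c e) :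
    detSum (fun e => c e • D e) = n.factorial * treePoly fst snd NoRel c := by
  classical
  have hterm : ∀ f : Fin n → E, |(Matrix.of ((fun e => c e • D e) ∘ f)).det| =
      ∑ T ∈ Finset.univ.filter (fun T => IsSTree fst snd NoRel T),
        if Function.Injective f ∧ Finset.univ.image f = T then ∏ e ∈ T, c e else 0 := by
    intro f
    have hsc : |(Matrix.of ((fun e => c e • D e) ∘ f)).det| =
        (∏ i, c (f i)) * |(Matrix.of (D ∘ f)).det| := by
      have : Matrix.of ((fun e => c e • D e) ∘ f) =
          Matrix.of fun i j => c (f i) * Matrix.of (D ∘ f) i j := by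
        ext i j
        simp
      rw [this, Matrix.det_mul_column, abs_mul,
        abs_of_nonneg (Finset.prod_nonneg fun i _ => hc _)]
    rw [hsc]
    by_cases h : Function.Injective f ∧ IsSTree fst snd NoRel (Finset.univ.image f)
    · rw [abs_det_eq_one hpot hbasis ht h.2.1, mul_one,
        Finset.sum_eq_single (Finset.univ.image f)]
      · rw [if_pos ⟨h.1, rfl⟩, Finset.prod_image fun i _ j _ hij => h.1 hij]
      · intro T _ hne
        exact if_neg fun h' => hne h'.2.symm
      · intro hn
        exact absurd (Finset.mem_filter.mpr ⟨Finset.mem_univ _, h.2⟩) hn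
    · have hz : (Matrix.of (D ∘ f)).det = 0 := by
        by_contra hne
        exact h (isSTree_of_det_ne_zero hcard hpot hbasis hne)
      rw [hz, abs_zero, mul_zero]
      refine (Finset.sum_eq_zero fun T hT => if_neg ?_).symm
      rintro ⟨h1, rfl⟩
      exact h ⟨h1, (Finset.mem_filter.mp hT).2⟩
  rw [detSum, Finset.sum_congr rfl fun f _ => hterm f, Finset.sum_comm, treePoly_eq,
    Finset.mul_sum]
  refine Finset.sum_congr rfl fun T hT => ?_
  rw [← Finset.sum_filter, Finset.sum_const,
    card_enum (card_of_isSTree hcard hpot hbasis (Finset.mem_filter.mp hT).2),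
    nsmul_eq_mul]

/-- The configuration zonotope has volume `Γ(c)`. -/
theorem volume_zonotope_eq_treePoly [Fintype V] {n : ℕ} (hcard : Fintype.card V = n + 1) {fst snd : E → V}
    {D : E → Fin n → ℝ} {pot : V → Fin n → ℝ} (hpot : ∀ e, D e = pot (snd e) - pot (fst e))
    {t : Fin n → E} (hbasis : ∀ i, D (t i) = Pi.single i 1)
    (ht : ConnVia fst snd (Finset.univ.image t) NoRel)
    {c : E → ℝ} (hc : ∀ e, 0 ≤ c e) :
    volume (zonotope fun e => c e • D e) = ENNReal.ofReal (treePoly fst snd NoRel c) := by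
  have h := factorial_mul_volume_zonotope n fun e => c e • D e
  rw [detSum_eq_treePoly hcard hpot hbasis ht hc, ENNReal.ofReal_mul (by positivity),
    ENNReal.ofReal_natCast] at h
  exact (ENNReal.mul_right_inj (by exact_mod_cast n.factorial_ne_zero)
    (ENNReal.natCast_ne_top _)).mp h

/-! ### The tree polynomial after adding an edge -/

lemma sum_finset_option (F : Finset (Option E) → ℝ) :
    ∑ T, F T = ∑ T : Finset E, F (T.map Function.Embedding.some) +
      ∑ T : Finset E, F (Finset.insertNone T) := by
  rw [← Fintype.sum_sumElim]
  symm
  refine Fintype.sum_bijective (Sum.elim (fun T : Finset E => T.map Function.Embedding.some)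
    (fun T : Finset E => Finset.insertNone T)) ⟨?_, ?_⟩ _ _ ?_
  · rintro (S | S) (T | T) h
    · exact congrArg _ (Finset.map_injective _ h)
    · have := Finset.ext_iff.mp h none
      simp at this
    · have := Finset.ext_iff.mp h none
      simp at this
    · exact congrArg _ (Finset.insertNone.injective h)
  · intro T
    by_cases hT : none ∈ T
    · exact ⟨Sum.inr (Finset.eraseNone T), by simp [hT]⟩
    · exact ⟨Sum.inl (Finset.eraseNone T), by simp [hT]⟩
  · rintro (T | T) <;> rfl

/-- Deletion-contraction bound for the graph with an extra edge of capacity `k` from `x` to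
`y`. -/
lemma treePoly_option_le {fst snd : E → V} {c : E → ℝ} (hc : ∀ e, 0 ≤ c e) (x y : V)
    {k : ℝ} (hk : 0 ≤ k) :
    treePoly (fun o : Option E => o.elim x fst) (fun o => o.elim y snd) NoRel
        (fun o => o.elim k c) ≤
      treePoly fst snd NoRel c + k * treePoly fst snd (Rid x y) c := by
  classical
  rw [treePoly_eq, treePoly_eq, treePoly_eq, Finset.sum_filter, Finset.sum_filter,
    Finset.sum_filter, sum_finset_option, Finset.mul_sum]
  have hprod : ∀ T : Finset E, 0 ≤ ∏ e ∈ T, c e := fun T => Finset.prod_nonneg fun e _ => hc e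
  refine add_le_add (Finset.sum_le_sum fun T _ => ?_) (Finset.sum_le_sum fun T _ => ?_)
  · rw [Finset.prod_map]
    split_ifs with h1 h2
    · rfl
    · exact absurd (isSTree_of_map_some h1) h2
    · exact hprod T
    · rfl
  · rw [Finset.prod_insertNone]
    split_ifs with h1 h2
    · rfl
    · exact absurd (isSTree_of_insertNone h1) h2
    · exact mul_nonneg hk (hprod T)
    · simp

/-- Translating `Z` along a segment: the part of `Z` lost is at most the volume gained. -/
lemma two_mul_volume_le {n : ℕ} {K K' : Set (Fin n → ℝ)} (hK : MeasurableSet K)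
    {w : Fin n → ℝ} (h : K ⊆ K') (hw : ∀ z ∈ K, z + w ∈ K') :
    volume K + volume K ≤ volume K' + volume {z ∈ K | z - w ∈ K} := by
  set S : Set (Fin n → ℝ) := {z | z - w ∈ K}
  have hS : MeasurableSet S := (measurable_id.sub_const w) hK
  have hvol : volume S = volume K := by
    simp only [S, sub_eq_add_neg]
    exact measure_preimage_add_right volume (-w) K
  have hsub : K ∪ S ⊆ K' := by
    rintro z (hz | hz)
    · exact h hz
    · simpa using hw _ hz
  calc volume K + volume K = volume K + volume S := by rw [hvol]
    _ = volume (K ∪ S) + volume (K ∩ S) := (measure_union_add_inter K hS).symm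
    _ ≤ volume K' + volume {z ∈ K | z - w ∈ K} := by
      gcongr
      exact le_rfl

end CreditNet

open CreditNet

/-- the failure probability of a size-`k` transaction from `x`
to `y` (direction given by any path) is at most `k·Γ_{x=y}(c)/Γ(c)`, so the
success probability is at least `1 − k·Γ_{x=y}(c)/Γ(c)`. -/
theorem stmt12 {V E : Type} [Fintype V] [Fintype E] [DecidableEq E]
    (fst snd : E → V) (n : ℕ) (hcard : Fintype.card V = n + 1)
    (hconn : ConnVia fst snd Finset.univ NoRel)
    (c : E → ℝ) (hc : ∀ e, 0 ≤ c e)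
    (D : E → Fin n → ℝ) (hD : IsSpanningRep fst snd D)
    (T0 : Finset E) (hT0 : IsSTree fst snd NoRel T0)
    (t : Fin n → E) (ht : Function.Injective t)
    (htT : ∀ i, t i ∈ T0) (hTt : ∀ e ∈ T0, ∃ i, t i = e)
    (hbasis : ∀ i : Fin n, D (t i) = Pi.single i 1)
    (hpos : 0 < treePoly fst snd NoRel c)
    (x y : V) (p : Walk fst snd x y) (k : ℝ) (hk : 0 ≤ k) :
    1 - (MeasureTheory.volume
          { z ∈ zonotope (fun e : E => c e • D e) |
            z - k • wsum D p ∈ zonotope (fun e : E => c e • D e) }).toReal /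
        (MeasureTheory.volume (zonotope (fun e : E => c e • D e))).toReal ≤
      k * treePoly fst snd (Rid x y) c / treePoly fst snd NoRel c := by
  have : Nonempty V := Fintype.card_pos_iff.mp (by omega)
  obtain ⟨pot, hpot⟩ := exists_potential hconn D hD.1
  have himg : Finset.univ.image t = T0 := by
    ext e
    simp only [Finset.mem_image, Finset.mem_univ, true_and]
    exact ⟨fun ⟨i, hi⟩ => hi ▸ htT i, hTt e⟩
  have htconn : ConnVia fst snd (Finset.univ.image t) NoRel := himg ▸ hT0.1
  have hZ := volume_zonotope_eq_treePoly hcard hpot hbasis htconn hc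
  set Z := zonotope (fun e : E => c e • D e) with hZdef
  let D' : Option E → Fin n → ℝ := fun o => o.elim (wsum D p) D
  let c' : Option E → ℝ := fun o => o.elim k c
  have hpot' : ∀ o : Option E, D' o = pot (o.elim y snd) - pot (o.elim x fst) := by
    rintro (_ | e)
    · exact wsum_eq_sub hpot p
    · exact hpot e
  have htconn' : ConnVia (fun o : Option E => o.elim x fst) (fun o => o.elim y snd)
      (Finset.univ.image (some ∘ t)) NoRel :=
    (conn_option_iff (by simp) (by simp [NoRel])).mpr htconn
  have hc' : ∀ o, 0 ≤ c' o := by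
    rintro (_ | e)
    · exact hk
    · exact hc e
  have hZ' := volume_zonotope_eq_treePoly (D := D') (t := some ∘ t) hcard hpot' hbasis htconn' hc'
  set Z' := zonotope (fun o : Option E => c' o • D' o) with hZ'def
  have hopt : Z' = {z | ∃ s ∈ Set.Icc (0 : ℝ) 1, ∃ z' ∈ Z, z = s • (k • wsum D p) + z'} :=
    zonotope_option _
  have hvol := two_mul_volume_le (isCompact_zonotope (fun e : E => c e • D e)).measurableSet
    (K' := Z') (w := k • wsum D p)
    (fun z hz => by rw [hopt]; exact ⟨0, by norm_num, z, hz, by simp⟩)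
    (fun z hz => by rw [hopt]; exact ⟨1, by norm_num, z, hz, by rw [one_smul, add_comm]⟩)
  rw [← hZdef, hZ, hZ'] at hvol
  set A := volume {z ∈ Z | z - k • wsum D p ∈ Z} with hA
  have hAtop : A ≠ ⊤ := by
    refine ne_top_of_le_ne_top (hZ ▸ ENNReal.ofReal_ne_top : volume Z ≠ ⊤) ?_
    exact measure_mono fun z hz => hz.1
  have hle := ENNReal.toReal_mono (by finiteness) hvol
  rw [ENNReal.toReal_add (by finiteness) (by finiteness), ENNReal.toReal_add (by finiteness) hAtop,
    ENNReal.toReal_ofReal hpos.le, ENNReal.toReal_ofReal (treePoly_nonneg _ _ _ hc')] at hle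
  have hdc := treePoly_option_le (fst := fst) (snd := snd) hc x y hk
  rw [hZ, ENNReal.toReal_ofReal hpos.le, one_sub_div hpos.ne']
  gcongr
  linarith
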